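/- arXiv:2307.14172 — 3 statements merged into one kernel-verified Lean document; each statement's English description precedes it below -/
import Mathlib

section
/- Let F_q be a finite field, a ∈ F_q, r > 0, and define f^{(a)} : F_q^r → ℂ by f^{(a)}(a_1,...,a_r) = 1 if Σ_k a_k = a and 0 otherwise. With the Möbius transform f_S(a_S) := Σ_{T ⊆ S} (-1)^{|S\T|} f(a_{(T)}) and the normalized Fourier transform at the tuple of trivial characters f̂_S(χ_0,...,χ_0) := (1/(q-1)^{|S|}) Σ_{a_S ∈ (F_q^*)^{|S|}} f_S(a_S), one has f̂^{(a)}_S(χ_0,...,χ_0) = 𝟙[S = ∅]/q − γ_a(q) · (1/q − 1)^{−|S|}, where γ_0(q) = 1/q − 1 and γ_a(q) = 1/q for a ≠ 0. -/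
/-- The Möbius transform `f_S` of `f : F_q^r → ℂ`, viewed as a function of a full
`r`-tuple: `f_S(a) = ∑_{T ⊆ S} (-1)^{|S \ T|} f(a_{(T)})`. -/
noncomputable def mobiusTransform {F : Type*} [Field F] {r : ℕ}
    (f : (Fin r → F) → ℂ) (S : Finset (Fin r)) (a : Fin r → F) : ℂ :=
  ∑ T ∈ S.powerset, (-1 : ℂ) ^ (S \ T).card * f (fun k => if k ∈ T then a k else 0)

lemma aux_units {F : Type*} [Field F] [Fintype F] [DecidableEq F] (g : F → ℂ) (h0 : g 0 = 0) :
    ∑ u : Fˣ, g u = ∑ x : F, g x := by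
  rw [← Fintype.sum_subtype_add_sum_subtype (fun x : F => x ≠ 0) g]
  have h2 : ∑ x : {x : F // ¬ x ≠ 0}, g x = 0 := by
    apply Finset.sum_eq_zero
    rintro ⟨x, hx⟩ _
    simp only [ne_eq, not_not] at hx
    simp [hx, h0]
  rw [h2, add_zero]
  exact Fintype.sum_equiv unitsEquivNeZero _ _ (fun u => rfl)

lemma aux_map_sum {F ι : Type*} [Field F] (ψ : AddChar F ℂ) (T : Finset ι) (b : ι → F) :
    ψ (∑ k ∈ T, b k) = ∏ k ∈ T, ψ (b k) := by
  classical
  induction T using Finset.induction_on with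
  | empty => simp
  | insert i s hi ih => rw [Finset.sum_insert hi, Finset.prod_insert hi, AddChar.map_add_eq_mul, ih]

lemma aux_mobius {F : Type*} [Field F] [Fintype F] [DecidableEq F] {r : ℕ} (a : F)
    (S : Finset (Fin r)) (b : Fin r → F) :
    mobiusTransform (fun x : Fin r → F => if ∑ k, x k = a then (1 : ℂ) else 0) S b =
      (1 / (Fintype.card F : ℂ)) * ∑ ψ : AddChar F ℂ, ψ (-a) * ∏ k ∈ S, (ψ (b k) - 1) := by
  have hq : (Fintype.card F : ℂ) ≠ 0 := by simp
  unfold mobiusTransform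
  have h1 : ∀ T : Finset (Fin r),
      (if ∑ k, (if k ∈ T then b k else 0) = a then (1:ℂ) else 0) =
      (1 / (Fintype.card F : ℂ)) * ∑ ψ : AddChar F ℂ, ψ (-a) * ∏ k ∈ T, ψ (b k) := by
    intro T
    have h2 : ∀ ψ : AddChar F ℂ, ψ (-a) * ∏ k ∈ T, ψ (b k) = ψ ((∑ k ∈ T, b k) - a) := by
      intro ψ
      rw [← aux_map_sum, ← AddChar.map_add_eq_mul]
      congr 1; ring
    simp_rw [h2]
    rw [AddChar.sum_apply_eq_ite]
    simp only [sub_eq_zero, Finset.sum_ite_mem, Finset.univ_inter]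
    split_ifs <;> simp [hq]
  simp only [h1]
  have h3 : ∀ ψ : AddChar F ℂ, ∏ k ∈ S, (ψ (b k) - 1) =
      ∑ T ∈ S.powerset, (-1 : ℂ) ^ (S \ T).card * ∏ k ∈ T, ψ (b k) := by
    intro ψ
    simp_rw [sub_eq_add_neg]
    rw [Finset.prod_add]
    refine Finset.sum_congr rfl fun T _ => ?_
    rw [Finset.prod_const, mul_comm]
  simp_rw [h3, Finset.mul_sum]
  rw [Finset.sum_comm]
  refine Finset.sum_congr rfl fun ψ _ => Finset.sum_congr rfl fun T _ => ?_
  ring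

theorem fourier_mobius_indicator_at_trivial {F : Type*} [Field F] [Fintype F]
    [DecidableEq F] {r : ℕ} (hr : 0 < r) (a : F) (S : Finset (Fin r)) :
    (1 / ((Fintype.card F : ℂ) - 1) ^ S.card) *
      ∑ b : {k // k ∈ S} → Fˣ,
        mobiusTransform
          (fun x : Fin r → F => if ∑ k, x k = a then (1 : ℂ) else 0) S
          (fun k => if h : k ∈ S then (b ⟨k, h⟩ : F) else 0) =
      (if S = ∅ then 1 / (Fintype.card F : ℂ) else 0) -
        (if a = 0 then 1 / (Fintype.card F : ℂ) - 1 else 1 / (Fintype.card F : ℂ)) *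
          (1 / (Fintype.card F : ℂ) - 1) ^ (-(S.card : ℤ)) := by
  have hq : (Fintype.card F : ℂ) ≠ 0 := by simp
  have hq1 : (Fintype.card F : ℂ) - 1 ≠ 0 := by
    rw [sub_ne_zero]
    exact_mod_cast (Fintype.one_lt_card (α := F)).ne'
  simp only [aux_mobius]
  have h1 : ∀ (ψ : AddChar F ℂ) (b : {k // k ∈ S} → Fˣ),
      ∏ k ∈ S, (ψ (if h : k ∈ S then (b ⟨k, h⟩ : F) else 0) - 1) =
      ∏ k : {k // k ∈ S}, (ψ (b k) - 1) := by
    intro ψ b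
    rw [← Finset.prod_coe_sort]
    refine Finset.prod_congr rfl fun k _ => ?_
    simp
  have h2 : ∀ ψ : AddChar F ℂ, ∑ u : Fˣ, (ψ u - 1) =
      if ψ = 0 then 0 else -(Fintype.card F : ℂ) := by
    intro ψ
    rw [aux_units (fun x => ψ x - 1) (by simp), Finset.sum_sub_distrib, AddChar.sum_eq_ite]
    split_ifs <;> simp
  have h3 : ∑ ψ : AddChar F ℂ, ψ (-a) * (if ψ = 0 then (0:ℂ) else -(Fintype.card F : ℂ)) ^ S.card
      = (if S = ∅ then 1 else 0) +
        ((if a = 0 then (Fintype.card F : ℂ) else 0) - 1) * (-(Fintype.card F : ℂ)) ^ S.card := by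
    have h4 : ∀ ψ : AddChar F ℂ,
        ψ (-a) * (if ψ = 0 then (0:ℂ) else -(Fintype.card F : ℂ)) ^ S.card =
        ψ (-a) * (-(Fintype.card F : ℂ)) ^ S.card +
        if ψ = 0 then (0:ℂ) ^ S.card - (-(Fintype.card F : ℂ)) ^ S.card else 0 := by
      intro ψ
      split_ifs with h
      · subst h; simp
      · simp
    simp_rw [h4]
    rw [Finset.sum_add_distrib, ← Finset.sum_mul, AddChar.sum_apply_eq_ite]
    simp only [Finset.sum_ite_eq', Finset.mem_univ, if_true, zero_pow_eq, Finset.card_eq_zero,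
      neg_eq_zero]
    ring
  rw [← Finset.mul_sum, Finset.sum_comm]
  have h6 : ∀ ψ : AddChar F ℂ, ∑ b : {k // k ∈ S} → Fˣ, ∏ k : {k // k ∈ S}, (ψ (b k) - 1) =
      ∏ k : {k // k ∈ S}, ∑ u : Fˣ, (ψ u - 1) := by
    intro ψ
    exact (Fintype.prod_sum (fun (_ : {k // k ∈ S}) (u : Fˣ) => (ψ u - 1))).symm
  simp_rw [h1, ← Finset.mul_sum, h6, h2, Finset.prod_const, Finset.card_univ,
    Fintype.card_coe]
  rw [h3]
  have h5 : (1 / (Fintype.card F : ℂ) - 1) ^ (-(S.card : ℤ)) =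
      (-(Fintype.card F : ℂ)) ^ S.card / ((Fintype.card F : ℂ) - 1) ^ S.card := by
    rw [zpow_neg, zpow_natCast, ← inv_pow, ← div_pow]
    congr 1
    have : 1 / (Fintype.card F : ℂ) - 1 = -((Fintype.card F : ℂ) - 1) / (Fintype.card F : ℂ) := by
      field_simp; ring
    rw [this, inv_div, div_neg, neg_div]
  rw [h5]
  by_cases hS : S = ∅
  · subst hS
    by_cases ha : a = 0
    · simp [ha]
    · simp [ha]
  · by_cases ha : a = 0
    · simp only [hS, ha, if_true, if_false]; field_simp; ring
    · simp only [hS, ha, if_false]; field_simp; ring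
end

section
/- Fix a prime power q and integer r > 0. Let M be uniformly random in the set of m × n rank-r matrices over F_q, and let X ∈ F_q^{m×r}, Y ∈ F_q^{r×n} be independent uniform random matrices. Then the total variation distance Σ_{N ∈ F_q^{m×n}} |P[XY = N] − P[M = N]| tends to 0 as m, n → ∞ with r, q fixed. -/
open Filter

namespace TVRank
open Matrix

lemma linv {F : Type*} [Field F] {m r : ℕ} (X : Matrix (Fin m) (Fin r) F)
    (h : ∀ v, X *ᵥ v = 0 → v = 0) : ∃ L : Matrix (Fin r) (Fin m) F, L * X = 1 := by
  obtain ⟨g, hg⟩ := LinearMap.exists_leftInverse_of_injective (Matrix.toLin' X)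
    (by rw [LinearMap.ker_eq_bot']; intro v hv; exact h v (by simpa using hv))
  refine ⟨LinearMap.toMatrix' g, ?_⟩
  have := congrArg LinearMap.toMatrix' hg
  rwa [LinearMap.toMatrix'_comp, LinearMap.toMatrix'_toLin', LinearMap.toMatrix'_id] at this

lemma rinv {F : Type*} [Field F] {n r : ℕ} (Y : Matrix (Fin r) (Fin n) F)
    (h : ∀ v, Yᵀ *ᵥ v = 0 → v = 0) : ∃ R : Matrix (Fin n) (Fin r) F, Y * R = 1 := by
  obtain ⟨L, hL⟩ := linv Yᵀ h
  refine ⟨Lᵀ, ?_⟩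
  have := congrArg Matrix.transpose hL
  simpa [Matrix.transpose_mul] using this

lemma rank_good {F : Type*} [Field F] {m n r : ℕ} (X : Matrix (Fin m) (Fin r) F)
    (Y : Matrix (Fin r) (Fin n) F) (hX : ∀ v, X *ᵥ v = 0 → v = 0)
    (hY : ∀ v, Yᵀ *ᵥ v = 0 → v = 0) : (X * Y).rank = r := by
  obtain ⟨L, hL⟩ := linv X hX
  obtain ⟨R, hR⟩ := rinv Y hY
  apply le_antisymm
  · exact (rank_mul_le_left _ _).trans (rank_le_width X)
  · have h1 : L * (X * Y) * R = 1 := by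
      rw [← Matrix.mul_assoc L, hL, Matrix.one_mul, hR]
    calc r = (1 : Matrix (Fin r) (Fin r) F).rank := by simp
      _ = (L * (X * Y) * R).rank := by rw [h1]
      _ ≤ (L * (X * Y)).rank := rank_mul_le_left _ _
      _ ≤ _ := rank_mul_le_right _ _

lemma inj_of_rank {F : Type*} [Field F] {m r : ℕ} (X : Matrix (Fin m) (Fin r) F)
    (h : r ≤ X.rank) : ∀ v, X *ᵥ v = 0 → v = 0 := by
  have h1 := LinearMap.finrank_range_add_finrank_ker X.mulVecLin
  have h2 : Module.finrank F (LinearMap.range X.mulVecLin) = X.rank := rfl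
  rw [h2, Module.finrank_fin_fun] at h1
  have h3 : Module.finrank F (LinearMap.ker X.mulVecLin) = 0 := by omega
  rw [Submodule.finrank_eq_zero, LinearMap.ker_eq_bot'] at h3
  intro v hv
  exact h3 v (by simpa using hv)

lemma exists_fact {F : Type*} [Field F] {m n r : ℕ} (N : Matrix (Fin m) (Fin n) F)
    (h : N.rank = r) : ∃ (X : Matrix (Fin m) (Fin r) F) (Y : Matrix (Fin r) (Fin n) F),
      X * Y = N := by
  have h2 : Module.finrank F (LinearMap.range N.mulVecLin) = r := h
  let b := Module.finBasisOfFinrankEq F _ h2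
  refine ⟨Matrix.of fun i k => (b k : Fin m → F) i, Matrix.of fun k j =>
    b.repr ⟨N.mulVecLin (Pi.single j 1), LinearMap.mem_range_self _ _⟩ k, ?_⟩
  ext i j
  have := b.sum_repr ⟨N.mulVecLin (Pi.single j 1), LinearMap.mem_range_self _ _⟩
  have := congrFun (congrArg Subtype.val this) i
  simp only [Submodule.coe_sum, Submodule.coe_smul, Finset.sum_apply, Pi.smul_apply,
    smul_eq_mul] at this
  simp only [Matrix.mul_apply, Matrix.of_apply]
  rw [Finset.sum_congr rfl (fun k _ => mul_comm _ _), this]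
  simp

lemma fiber_card {F : Type*} [Field F] {m n r : ℕ} (N : Matrix (Fin m) (Fin n) F)
    (h : N.rank = r) :
    Nat.card {xy : Matrix (Fin m) (Fin r) F × Matrix (Fin r) (Fin n) F // xy.1 * xy.2 = N}
      = Nat.card (Matrix (Fin r) (Fin r) F)ˣ := by
  obtain ⟨X0, Y0, rfl⟩ := exists_fact N h
  obtain ⟨L, hL⟩ := linv X0 (inj_of_rank X0 (h.symm.le.trans (rank_mul_le_left _ _)))
  obtain ⟨R, hR⟩ := rinv Y0 (inj_of_rank Y0ᵀ (by
    rw [rank_transpose]; exact h.symm.le.trans (rank_mul_le_right _ _)))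
  have key : ∀ (X : Matrix (Fin m) (Fin r) F) (Y : Matrix (Fin r) (Fin n) F),
      X * Y = X0 * Y0 → (L * X) * (Y * R) = 1 := by
    intro X Y hXY
    rw [Matrix.mul_assoc, ← Matrix.mul_assoc X, hXY, Matrix.mul_assoc X0, hR, Matrix.mul_one, hL]
  refine Nat.card_congr
    { toFun := fun p => ⟨L * p.1.1, p.1.2 * R, key _ _ p.2, mul_eq_one_comm.1 (key _ _ p.2)⟩
      invFun := fun A => ⟨(X0 * A.1, A.2 * Y0), ?_⟩
      left_inv := ?_
      right_inv := ?_ }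
  · show X0 * A.1 * (A.2 * Y0) = X0 * Y0
    rw [Matrix.mul_assoc, ← Matrix.mul_assoc A.1, A.3, Matrix.one_mul]
  · rintro ⟨⟨X, Y⟩, hXY⟩
    have k2 := mul_eq_one_comm.1 (key X Y hXY)
    have hXY : X * Y = X0 * Y0 := hXY
    have e1 : X * (Y * R) = X0 := by
      rw [← Matrix.mul_assoc, hXY, Matrix.mul_assoc, hR, Matrix.mul_one]
    have e2 : (L * X) * Y = Y0 := by
      rw [Matrix.mul_assoc, hXY, ← Matrix.mul_assoc, hL, Matrix.one_mul]
    apply Subtype.ext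
    apply Prod.ext
    · show X0 * (L * X) = X
      rw [← e1, Matrix.mul_assoc, k2, Matrix.mul_one]
    · show Y * R * Y0 = Y
      rw [← e2, ← Matrix.mul_assoc, k2, Matrix.one_mul]
  · intro A
    apply Units.ext
    show L * (X0 * A.1) = A.1
    rw [← Matrix.mul_assoc, hL, Matrix.one_mul]

lemma ker_card {F : Type*} [Field F] [Fintype F] {m r : ℕ} (v : Fin r → F) (hv : v ≠ 0) :
    Nat.card {X : Matrix (Fin m) (Fin r) F // X *ᵥ v = 0} * Fintype.card F ^ m
      ≤ Nat.card (Matrix (Fin m) (Fin r) F) := by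
  obtain ⟨i, hi⟩ := Function.ne_iff.1 hv
  let u : Fin r → F := Pi.single i (v i)⁻¹
  have hu : u ⬝ᵥ v = 1 := by simpa [u] using inv_mul_cancel₀ hi
  have e : Nat.card (Fin m → F) = Fintype.card F ^ m := by simp
  rw [← e, ← Nat.card_prod]
  refine Nat.card_le_card_of_injective
    (fun p : {X : Matrix (Fin m) (Fin r) F // X *ᵥ v = 0} × (Fin m → F) =>
      p.1.1 + vecMulVec p.2 u) ?_
  have k : ∀ p : {X : Matrix (Fin m) (Fin r) F // X *ᵥ v = 0} × (Fin m → F),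
      (p.1.1 + vecMulVec p.2 u) *ᵥ v = p.2 := by
    intro p
    rw [Matrix.add_mulVec, p.1.2, zero_add, vecMulVec_mulVec, hu]
    simp
  intro p q hpq
  simp only at hpq
  have h2 : p.2 = q.2 := by rw [← k p, ← k q, hpq]
  rw [h2] at hpq
  exact Prod.ext (Subtype.ext (add_right_cancel hpq)) h2

lemma bad_card {F : Type*} [Field F] [Fintype F] {m r : ℕ} :
    (Nat.card {X : Matrix (Fin m) (Fin r) F // ¬ ∀ v, X *ᵥ v = 0 → v = 0} : ℝ)
      ≤ (Fintype.card F : ℝ) ^ r / (Fintype.card F : ℝ) ^ m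
        * Nat.card (Matrix (Fin m) (Fin r) F) := by
  classical
  have hq : (0 : ℝ) < (Fintype.card F : ℝ) ^ m := by
    have : 0 < Fintype.card F := Fintype.card_pos
    positivity
  rw [div_mul_eq_mul_div, le_div_iff₀ hq]
  norm_cast
  have h1 : Nat.card {X : Matrix (Fin m) (Fin r) F // ¬ ∀ v, X *ᵥ v = 0 → v = 0}
      ≤ ∑ v ∈ (Finset.univ : Finset (Fin r → F)).filter (· ≠ 0),
        Nat.card {X : Matrix (Fin m) (Fin r) F // X *ᵥ v = 0} := by
    simp only [Nat.card_eq_fintype_card, Fintype.card_subtype]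
    refine le_trans (Finset.card_le_card ?_) Finset.card_biUnion_le
    intro X hX
    simp only [Finset.mem_filter, Finset.mem_univ, true_and, not_forall] at hX
    obtain ⟨v, h, h'⟩ := hX
    simp only [Finset.mem_biUnion, Finset.mem_filter, Finset.mem_univ, true_and]
    exact ⟨v, h', h⟩
  calc _ ≤ _ := Nat.mul_le_mul_right _ h1
    _ = ∑ v ∈ (Finset.univ : Finset (Fin r → F)).filter (· ≠ 0),
        Nat.card {X : Matrix (Fin m) (Fin r) F // X *ᵥ v = 0} * Fintype.card F ^ m := by
      rw [Finset.sum_mul]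
    _ ≤ ∑ v ∈ (Finset.univ : Finset (Fin r → F)).filter (· ≠ 0),
        Nat.card (Matrix (Fin m) (Fin r) F) :=
      Finset.sum_le_sum fun v hv => ker_card v (Finset.mem_filter.1 hv).2
    _ ≤ ∑ v : Fin r → F, Nat.card (Matrix (Fin m) (Fin r) F) :=
      Finset.sum_le_sum_of_subset (Finset.filter_subset _ _)
    _ = _ := by simp

lemma tv_bound {α : Type*} [Fintype α] (p : α → Prop) [DecidablePred p] (f : α → ℝ) (k : ℝ)
    (h0 : ∀ a, 0 ≤ f a) (h1 : ∑ a, f a = 1) (hk : ∀ a, p a → f a = k) :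
    ∑ a, |f a - (if p a then (1:ℝ) else 0) / (Nat.card {a // p a} : ℝ)|
      ≤ 2 * ∑ a with ¬ p a, f a := by
  have hb : ∀ a ∈ Finset.univ.filter (fun a => ¬ p a),
      |f a - (if p a then (1:ℝ) else 0) / (Nat.card {a // p a} : ℝ)| = f a := by
    intro a ha
    simp [(Finset.mem_filter.1 ha).2, abs_of_nonneg (h0 a)]
  have hs := Finset.sum_filter_add_sum_filter_not Finset.univ p f
  rw [← Finset.sum_filter_add_sum_filter_not Finset.univ p, Finset.sum_congr rfl hb, two_mul]
  gcongr
  rw [h1] at hs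
  have hg : ∀ a ∈ Finset.univ.filter p,
      |f a - (if p a then (1:ℝ) else 0) / (Nat.card {a // p a} : ℝ)|
        = |k - 1 / (Nat.card {a // p a} : ℝ)| := by
    intro a ha
    have := (Finset.mem_filter.1 ha).2
    simp [this, hk a this]
  have hg' : ∑ a with p a, f a = (Nat.card {a // p a} : ℝ) * k := by
    rw [Finset.sum_congr rfl (fun a ha => hk a (Finset.mem_filter.1 ha).2)]
    simp [Fintype.card_subtype]
  have hn : 0 ≤ ∑ a with ¬ p a, f a := Finset.sum_nonneg fun a _ => h0 a
  rw [Finset.sum_congr rfl hg, Finset.sum_const, nsmul_eq_mul, ← Fintype.card_subtype,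
    ← Nat.card_eq_fintype_card]
  rw [hg'] at hs
  rcases Nat.eq_zero_or_pos (Nat.card {a // p a}) with h | h
  · rw [h]; simpa using hn
  · have hc : (0:ℝ) < (Nat.card {a // p a} : ℝ) := by exact_mod_cast h
    rw [← abs_of_pos hc, ← abs_mul, abs_of_pos hc, mul_sub, mul_one_div_cancel hc.ne']
    rw [abs_of_nonpos (by linarith)]
    linarith

lemma main_bound {F : Type*} [Field F] [Fintype F] [DecidableEq F] (m n r : ℕ) :
    ∑ N : Matrix (Fin m) (Fin n) F,
          |((Nat.card {xy : Matrix (Fin m) (Fin r) F × Matrix (Fin r) (Fin n) F //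
                xy.1 * xy.2 = N} : ℝ) /
              (Nat.card (Matrix (Fin m) (Fin r) F × Matrix (Fin r) (Fin n) F) : ℝ) -
            (if N.rank = r then (1 : ℝ) else 0) /
              (Nat.card {M : Matrix (Fin m) (Fin n) F // M.rank = r} : ℝ))|
      ≤ 2 * ((Fintype.card F : ℝ) ^ r / (Fintype.card F : ℝ) ^ m
          + (Fintype.card F : ℝ) ^ r / (Fintype.card F : ℝ) ^ n) := by
  have hT : (0:ℝ) < (Nat.card (Matrix (Fin m) (Fin r) F × Matrix (Fin r) (Fin n) F) : ℝ) := by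
    exact_mod_cast Nat.card_pos
  refine (tv_bound (fun N : Matrix (Fin m) (Fin n) F => N.rank = r) _
    ((Nat.card (Matrix (Fin r) (Fin r) F)ˣ : ℝ) / _) (fun N => by positivity) ?_
    (fun N hN => by rw [fiber_card N hN])).trans ?_
  · rw [← Finset.sum_div, div_eq_one_iff_eq hT.ne']
    norm_cast
    simp only [Nat.card_eq_fintype_card, Fintype.card_subtype]
    rw [← Finset.card_univ]
    exact (Finset.card_eq_sum_card_fiberwise (f := fun xy :
      Matrix (Fin m) (Fin r) F × Matrix (Fin r) (Fin n) F => xy.1 * xy.2)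
      (t := Finset.univ) (by simp)).symm
  · gcongr
    rw [← Finset.sum_div, div_le_iff₀ hT]
    have h1 : ∑ N : Matrix (Fin m) (Fin n) F with ¬ N.rank = r,
        Nat.card {xy : Matrix (Fin m) (Fin r) F × Matrix (Fin r) (Fin n) F //
                xy.1 * xy.2 = N} ≤
        Nat.card {X : Matrix (Fin m) (Fin r) F // ¬ ∀ v, X *ᵥ v = 0 → v = 0}
          * Nat.card (Matrix (Fin r) (Fin n) F)
        + Nat.card (Matrix (Fin m) (Fin r) F) *
          Nat.card {X : Matrix (Fin n) (Fin r) F // ¬ ∀ v, X *ᵥ v = 0 → v = 0} := by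
      classical
      simp only [Nat.card_eq_fintype_card, Fintype.card_subtype]
      have e := Finset.card_eq_sum_card_fiberwise (f := fun xy :
        Matrix (Fin m) (Fin r) F × Matrix (Fin r) (Fin n) F => xy.1 * xy.2)
        (s := Finset.univ.filter fun xy => ¬ (xy.1 * xy.2).rank = r)
        (t := Finset.univ.filter fun N => ¬ N.rank = r) (by intro x hx; simpa using hx)
      have e2 : ∑ N : Matrix (Fin m) (Fin n) F with ¬ N.rank = r,
          (Finset.univ.filter fun xy :
            Matrix (Fin m) (Fin r) F × Matrix (Fin r) (Fin n) F => xy.1 * xy.2 = N).card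
          = (Finset.univ.filter fun xy : Matrix (Fin m) (Fin r) F × Matrix (Fin r) (Fin n) F
              => ¬ (xy.1 * xy.2).rank = r).card := by
        rw [e]
        refine Finset.sum_congr rfl fun N hN => ?_
        congr 1
        ext xy
        have := (Finset.mem_filter.1 hN).2
        simp only [Finset.mem_filter, Finset.mem_univ, true_and]
        constructor
        · intro h; exact ⟨by rwa [h], h⟩
        · exact fun h => h.2
      rw [e2]
      have e3 : (Finset.univ.filter fun X : Matrix (Fin n) (Fin r) F =>
          ¬ ∀ v, X *ᵥ v = 0 → v = 0).card =
          (Finset.univ.filter fun Y : Matrix (Fin r) (Fin n) F =>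
          ¬ ∀ v, Yᵀ *ᵥ v = 0 → v = 0).card := by
        refine Finset.card_bij' (fun X _ => Xᵀ) (fun Y _ => Yᵀ) ?_ ?_ ?_ ?_ <;> simp
      rw [e3, ← Finset.card_univ, ← Finset.card_univ, ← Finset.card_product,
        ← Finset.card_product]
      refine le_trans (Finset.card_le_card ?_) (Finset.card_union_le _ _)
      rintro ⟨X, Y⟩ h
      simp only [Finset.mem_filter, Finset.mem_univ, true_and, Finset.mem_union,
        Finset.mem_product, and_true] at h ⊢
      by_contra hc
      rw [not_or, not_not, not_not] at hc
      exact h (rank_good X Y hc.1 hc.2)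
    have h1' := (Nat.cast_le (α := ℝ)).2 h1
    push_cast at h1'
    refine h1'.trans ?_
    have hY : Nat.card (Matrix (Fin n) (Fin r) F) = Nat.card (Matrix (Fin r) (Fin n) F) :=
      Nat.card_congr ⟨fun X => Xᵀ, fun X => Xᵀ, fun _ => rfl, fun _ => rfl⟩
    have b1 := bad_card (F := F) (m := m) (r := r)
    have b2 := bad_card (F := F) (m := n) (r := r)
    rw [hY] at b2
    rw [Nat.card_prod, Nat.cast_mul]
    have c1 := mul_le_mul_of_nonneg_right b1
      (Nat.cast_nonneg (α := ℝ) (Nat.card (Matrix (Fin r) (Fin n) F)))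
    have c2 := mul_le_mul_of_nonneg_left b2
      (Nat.cast_nonneg (α := ℝ) (Nat.card (Matrix (Fin m) (Fin r) F)))
    linarith

end TVRank

theorem totalVariation_uniform_mul_rank_tendsto_zero
    {F : Type*} [Field F] [Fintype F] [DecidableEq F] (r : ℕ) (hr : 0 < r) :
    Tendsto
      (fun p : ℕ × ℕ =>
        ∑ N : Matrix (Fin p.1) (Fin p.2) F,
          |((Nat.card {xy : Matrix (Fin p.1) (Fin r) F × Matrix (Fin r) (Fin p.2) F //
                xy.1 * xy.2 = N} : ℝ) /
              (Nat.card (Matrix (Fin p.1) (Fin r) F × Matrix (Fin r) (Fin p.2) F) : ℝ) -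
            (if N.rank = r then (1 : ℝ) else 0) /
              (Nat.card {M : Matrix (Fin p.1) (Fin p.2) F // M.rank = r} : ℝ))|)
      atTop (nhds 0) := by
  have hq : (1:ℝ) < (Fintype.card F : ℝ) := by exact_mod_cast Fintype.one_lt_card
  have t : Tendsto (fun m : ℕ => (Fintype.card F : ℝ) ^ r / (Fintype.card F : ℝ) ^ m)
      atTop (nhds 0) :=
    tendsto_const_nhds.div_atTop (tendsto_pow_atTop_atTop_of_one_lt hq)
  have tt : Tendsto (fun p : ℕ × ℕ => 2 * ((Fintype.card F : ℝ) ^ r / (Fintype.card F : ℝ) ^ p.1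
          + (Fintype.card F : ℝ) ^ r / (Fintype.card F : ℝ) ^ p.2)) atTop (nhds 0) := by
    rw [← prod_atTop_atTop_eq]
    simpa using ((t.comp tendsto_fst).add (t.comp tendsto_snd)).const_mul 2
  exact squeeze_zero (fun p => Finset.sum_nonneg fun _ _ => abs_nonneg _)
    (fun p => TVRank.main_bound p.1 p.2 r) tt
end

section
/- Fix a prime power q, an integer r > 0, and a nonempty proper subset A ⊆ F_q. Let M be uniformly random in the set of m × n rank-r matrices over F_q, and let ct_A(M) be the number of entries of M in A. Set γ_A(q) := Σ_{a∈A} γ_a(q) with γ_0(q) = 1/q − 1 and γ_a(q) = 1/q for a ≠ 0, μ := (|A|/q − γ_A(q)/q^r) m n, and σ² := γ_A(q)² q^{-r}(1 − q^{-r})(m+n) m n. Then as m, n → ∞ (with q, r, A fixed), (ct_A(M) − μ)/σ converges in distribution to a standard normal random variable. -/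
open Filter

/-- Number of entries of the matrix `M` that belong to `A`. -/
def entryCount {F : Type*} [DecidableEq F] {m n : ℕ} (A : Finset F)
    (M : Matrix (Fin m) (Fin n) F) : ℕ :=
  (Finset.univ.filter (fun ij : Fin m × Fin n => M ij.1 ij.2 ∈ A)).card

/-- `γ_A(q) = ∑_{a ∈ A} γ_a(q)`, with `γ_0(q) = 1/q - 1` and `γ_a(q) = 1/q` for `a ≠ 0`. -/
noncomputable def gammaA {F : Type*} [Field F] [Fintype F] [DecidableEq F] (A : Finset F) : ℝ :=
  ∑ a ∈ A, if a = 0 then 1 / (Fintype.card F : ℝ) - 1 else 1 / (Fintype.card F : ℝ)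

open Topology

lemma levy_finite (Ω : ℕ × ℕ → Type*) [∀ p, Fintype (Ω p)] (T : ∀ p, Ω p → ℝ)
    (h : ∀ s : ℝ, Tendsto (fun p => (∑ ω : Ω p, Complex.exp (s * T p ω * Complex.I)) /
      (Fintype.card (Ω p) : ℂ)) atTop (𝓝 (Complex.exp (-(s:ℂ)^2/2)))) (t : ℝ) :
    Tendsto (fun p => (Nat.card {ω : Ω p // T p ω ≤ t} : ℝ) / (Fintype.card (Ω p) : ℝ)) atTop
      (𝓝 ((ProbabilityTheory.gaussianReal 0 1 (Set.Iic t)).toReal)) := by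
  classical
  have hne : ∀ᶠ p in atTop, Fintype.card (Ω p) ≠ 0 := by
    have h0 := h 0
    have := h0.eventually_ne (b₂ := (0:ℂ)) (by simp)
    filter_upwards [this] with p hp hc
    apply hp
    simp [hc]
  let ν0 : ℕ × ℕ → MeasureTheory.Measure ℝ := fun p =>
    (Fintype.card (Ω p) : ENNReal)⁻¹ • ∑ ω : Ω p, MeasureTheory.Measure.dirac (T p ω)
  have hν0 : ∀ p, Fintype.card (Ω p) ≠ 0 → MeasureTheory.IsProbabilityMeasure (ν0 p) := by
    intro p hp
    constructor
    simp only [ν0, MeasureTheory.Measure.smul_apply, MeasureTheory.Measure.finsetSum_apply]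
    simp
    exact ENNReal.inv_mul_cancel (by exact_mod_cast hp) (by simp)
  let ν : ℕ × ℕ → MeasureTheory.ProbabilityMeasure ℝ := fun p =>
    if hp : Fintype.card (Ω p) ≠ 0 then ⟨ν0 p, hν0 p hp⟩ else ⟨MeasureTheory.Measure.dirac 0, inferInstance⟩
  have hν : ∀ p, Fintype.card (Ω p) ≠ 0 → (ν p : MeasureTheory.Measure ℝ) = ν0 p := by
    intro p hp
    have : ν p = ⟨ν0 p, hν0 p hp⟩ := dif_pos hp
    rw [this]; rfl
  have hlim : Tendsto ν atTop (𝓝 (⟨ProbabilityTheory.gaussianReal 0 1, inferInstance⟩ : MeasureTheory.ProbabilityMeasure ℝ)) := by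
    rw [tendsto_iff_seq_tendsto]
    intro x hx
    refine MeasureTheory.ProbabilityMeasure.tendsto_iff_tendsto_charFun.2 fun s ↦ ?_
    have h1 := (h s).comp hx
    have e2 : MeasureTheory.charFun (ProbabilityTheory.gaussianReal 0 1) s = Complex.exp (-(s:ℂ)^2/2) := by
      rw [ProbabilityTheory.charFun_gaussianReal]; congr 1; push_cast; ring
    change Tendsto _ _ (𝓝 (MeasureTheory.charFun (ProbabilityTheory.gaussianReal 0 1) s))
    rw [e2]
    refine h1.congr' ?_
    filter_upwards [hx.eventually hne] with k hk
    simp only [Function.comp]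
    rw [hν _ hk, MeasureTheory.charFun_apply_real]
    simp only [ν0]
    rw [MeasureTheory.integral_smul_measure, MeasureTheory.integral_finsetSum_measure]
    · simp [div_eq_inv_mul]
    · intro i _
      exact MeasureTheory.integrable_dirac (by simp)
  have h3 := MeasureTheory.ProbabilityMeasure.tendsto_measure_of_null_frontier_of_tendsto' hlim (E := Set.Iic t) (by
    have : MeasureTheory.NullSingletonClass (ProbabilityTheory.gaussianReal 0 1) := ProbabilityTheory.nullSingletonClass_gaussianReal (by simp)
    simp)
  have h4 := (ENNReal.tendsto_toReal (MeasureTheory.measure_ne_top (ProbabilityTheory.gaussianReal 0 1) (Set.Iic t))).comp h3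
  refine h4.congr' ?_
  filter_upwards [hne] with p hp
  simp only [Function.comp]
  rw [hν _ hp]
  simp only [ν0, MeasureTheory.Measure.smul_apply, MeasureTheory.Measure.finsetSum_apply]
  simp [MeasureTheory.Measure.dirac_apply', Set.indicator_apply, Finset.sum_ite, Fintype.card_subtype, div_eq_inv_mul]

lemma var_sum {V : Type*} [Fintype V] [Nonempty V] (k : V → ℝ) (hk : ∑ x, k x = 0) (m : ℕ) :
    (∑ X : Fin m → V, ∑ i, k (X i) = 0) ∧
    (∑ X : Fin m → V, (∑ i, k (X i)) ^ 2) = m * (∑ x, k x ^ 2) / Fintype.card V * (Fintype.card V : ℝ) ^ m := by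
  have hc : (Fintype.card V : ℝ) ≠ 0 := by exact_mod_cast Fintype.card_ne_zero
  induction m with
  | zero => simp
  | succ m ih =>
    obtain ⟨ih1, ih2⟩ := ih
    constructor
    · rw [← (Fin.consEquiv (fun _ => V)).sum_comp, Fintype.sum_prod_type]
      simp [Fin.sum_univ_succ, Finset.sum_add_distrib, ih1, ← Finset.mul_sum, hk]
    · rw [← (Fin.consEquiv (fun _ => V)).sum_comp, Fintype.sum_prod_type]
      simp only [Fin.sum_univ_succ, Fin.consEquiv_apply, Fin.cons_zero, Fin.cons_succ, add_sq, Finset.sum_add_distrib,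
        ih2, ← Finset.mul_sum, ih1]
      simp only [mul_zero, Finset.sum_const, Finset.card_univ, Fintype.card_pi, Finset.prod_const, smul_eq_mul, nsmul_eq_mul, ← Finset.mul_sum]
      simp
      field_simp
      ring

lemma exp_sum {V : Type*} [Fintype V] (k : V → ℂ) (m : ℕ) :
    ∑ X : Fin m → V, Complex.exp (∑ i, k (X i)) = (∑ x, Complex.exp (k x)) ^ m := by
  classical
  simp only [Complex.exp_sum]
  have := Finset.prod_univ_sum (fun _ : Fin m => (Finset.univ : Finset V)) (fun _ x => Complex.exp (k x))
  simp at this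
  exact this.symm

lemma pow_sub_pow_le (z w : ℂ) (hz : ‖z‖ ≤ 1) (hw : ‖w‖ ≤ 1) (m : ℕ) : ‖z ^ m - w ^ m‖ ≤ m * ‖z - w‖ := by
  induction m with
  | zero => simp
  | succ m ih =>
    have : z ^ (m+1) - w ^ (m+1) = z * (z ^ m - w ^ m) + (z - w) * w ^ m := by ring
    rw [this]
    have h1 : ‖w ^ m‖ ≤ 1 := by rw [norm_pow]; exact pow_le_one₀ (norm_nonneg _) hw
    calc _ ≤ ‖z‖ * ‖z ^ m - w ^ m‖ + ‖z - w‖ * ‖w ^ m‖ := by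
            refine (norm_add_le _ _).trans ?_; rw [norm_mul, norm_mul]
      _ ≤ 1 * (m * ‖z - w‖) + ‖z - w‖ * 1 := by gcongr
      _ = _ := by push_cast; ring

lemma phi_bound {V : Type*} [Fintype V] [Nonempty V] (g : V → ℝ) (hg : ∑ x, g x = 0) (v : ℝ)
    (hv : ∑ x, g x ^ 2 = v * Fintype.card V) :
    ∃ C δ : ℝ, 0 < δ ∧ 0 ≤ C ∧ ∀ u : ℝ, |u| ≤ δ →
      ‖(∑ x, Complex.exp (u * g x * Complex.I)) / (Fintype.card V : ℂ) - Complex.exp (-(v * u ^ 2 / 2 : ℝ))‖ ≤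
        C * |u| ^ 3 := by
  have hc : (0:ℝ) < (Fintype.card V : ℝ) := by exact_mod_cast Fintype.card_pos
  have hcC : (Fintype.card V : ℂ) ≠ 0 := by exact_mod_cast Fintype.card_ne_zero
  obtain ⟨K, hK1, hK⟩ : ∃ K : ℝ, 1 ≤ K ∧ ∀ x, |g x| ≤ K := by
    refine ⟨1 + ∑ x, |g x|, by have := Finset.sum_nonneg (fun x (_ : x ∈ Finset.univ) => abs_nonneg (g x)); linarith, fun x => ?_⟩
    have := Finset.single_le_sum (fun x (_ : x ∈ Finset.univ) => abs_nonneg (g x)) (Finset.mem_univ x)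
    linarith
  have hK0 : 0 < K := by linarith
  refine ⟨K ^ 3 + v ^ 2, 1 / (K + |v|), by positivity, by positivity, fun u hu => ?_⟩
  have hu' : |u| * (K + |v|) ≤ 1 := by rwa [le_div_iff₀ (by positivity)] at hu
  have hu1 : |u| * K ≤ 1 := le_trans (by gcongr; linarith [abs_nonneg v]) hu'
  have hu3 : |u| ≤ 1 := by nlinarith [abs_nonneg u]
  have hu2 : |v| * |u| ^ 2 ≤ 1 := by
    have : |u| * |v| ≤ 1 := le_trans (by gcongr; linarith) hu'
    nlinarith [abs_nonneg u, abs_nonneg v]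
  have h1 : ∀ x, ‖Complex.exp (u * g x * Complex.I) - (1 + u * g x * Complex.I - u ^ 2 * g x ^ 2 / 2)‖ ≤ K ^ 3 * |u| ^ 3 := by
    intro x
    have hn : ‖(u * g x * Complex.I : ℂ)‖ ≤ K * |u| := by
      simp only [norm_mul, Complex.norm_real, Complex.norm_I, mul_one, Real.norm_eq_abs]
      rw [mul_comm]; gcongr; exact hK x
    have := Complex.exp_bound (x := u * g x * Complex.I) (by linarith) (n := 3) (by norm_num)
    refine le_trans (le_of_eq ?_) (this.trans ?_)
    · congr 2
      simp [Finset.sum_range_succ, Nat.factorial, mul_pow]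
      ring
    · calc _ ≤ (K * |u|) ^ 3 * 1 := by
            gcongr
            norm_num [Nat.factorial]
        _ = _ := by ring
  have h2 : ‖Complex.exp (-(v * u ^ 2 / 2 : ℝ)) - (1 - v * u ^ 2 / 2)‖ ≤ v ^ 2 * |u| ^ 3 := by
    have hn : ‖(-(v * u ^ 2 / 2 : ℝ) : ℂ)‖ = |v| * |u| ^ 2 / 2 := by
      simp only [norm_neg, Complex.norm_real]
      simp [abs_mul, abs_div]
    have := Complex.exp_bound (x := (-(v * u ^ 2 / 2 : ℝ) : ℂ)) (by rw [hn]; linarith) (n := 2) (by norm_num)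
    refine le_trans (le_of_eq ?_) (this.trans ?_)
    · congr 2
      simp [Finset.sum_range_succ, Nat.factorial]
      ring
    · rw [hn]
      calc _ ≤ (|v| * |u| ^ 2 / 2) ^ 2 * 1 := by
            gcongr
            norm_num [Nat.factorial]
        _ = |v| ^ 2 * |u| ^ 3 * (|u| / 4) := by ring
        _ ≤ |v| ^ 2 * |u| ^ 3 * 1 := by gcongr; linarith
        _ = _ := by rw [sq_abs]; ring
  have h3 : ((∑ x, (1 + u * g x * Complex.I - u ^ 2 * g x ^ 2 / 2)) / (Fintype.card V : ℂ)) = 1 - v * u ^ 2 / 2 := by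
    have e1 : (∑ x, (g x : ℂ)) = 0 := by exact_mod_cast congrArg Complex.ofReal hg
    have e2 : (∑ x, (g x : ℂ) ^ 2) = v * Fintype.card V := by exact_mod_cast congrArg Complex.ofReal hv
    rw [Finset.sum_sub_distrib, Finset.sum_add_distrib, ← Finset.sum_mul, ← Finset.mul_sum, ← Finset.sum_div, ← Finset.mul_sum, e1, e2]
    simp
    field_simp
  have h4 : ‖(∑ x, Complex.exp (u * g x * Complex.I)) / (Fintype.card V : ℂ) - (1 - v * u ^ 2 / 2)‖ ≤ K ^ 3 * |u| ^ 3 := by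
    rw [← h3, ← sub_div, ← Finset.sum_sub_distrib, norm_div, Complex.norm_natCast, div_le_iff₀ hc]
    refine (norm_sum_le _ _).trans ?_
    refine (Finset.sum_le_sum fun x _ => h1 x).trans ?_
    simp
    linarith
  have h5 := norm_sub_le ((∑ x, Complex.exp (u * g x * Complex.I)) / (Fintype.card V : ℂ) - (1 - v * u ^ 2 / 2))
    (Complex.exp (-(v * u ^ 2 / 2 : ℝ)) - (1 - v * u ^ 2 / 2))
  rw [sub_sub_sub_cancel_right] at h5
  linarith

lemma u_tendsto {ι : Type*} {l : Filter ι} (a b : ι → ℕ) (ha : Tendsto a l atTop) (hb : Tendsto b l atTop)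
    (v : ℝ) (hv : 0 < v) (s : ℝ) :
    Tendsto (fun p => s * b p / Real.sqrt (v * (a p + b p) * a p * b p)) l (𝓝 0) := by
  have h1 : Tendsto (fun p => |s| / Real.sqrt (v * a p)) l (𝓝 0) := by
    refine Tendsto.div_atTop tendsto_const_nhds ?_
    exact Real.tendsto_sqrt_atTop.comp ((tendsto_natCast_atTop_atTop.comp ha).const_mul_atTop hv)
  refine squeeze_zero_norm' ?_ h1
  filter_upwards [ha.eventually_gt_atTop 0, hb.eventually_gt_atTop 0] with p hpa hpb
  have hpa' : (0:ℝ) < a p := by exact_mod_cast hpa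
  have hpb' : (0:ℝ) < b p := by exact_mod_cast hpb
  rw [Real.norm_eq_abs, abs_div, abs_mul, abs_of_pos hpb', abs_of_nonneg (Real.sqrt_nonneg _),
    div_le_div_iff₀ (by positivity) (by positivity), mul_assoc]
  gcongr
  apply Real.le_sqrt_of_sq_le
  rw [mul_pow, Real.sq_sqrt (by positivity)]
  nlinarith [mul_pos (mul_pos hv hpa') (mul_pos hpa' hpb')]

lemma phi_pow {V : Type*} [Fintype V] [Nonempty V] (g : V → ℝ) (hg : ∑ x, g x = 0) (v : ℝ) (hv0 : 0 < v)
    (hv : ∑ x, g x ^ 2 = v * Fintype.card V)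
    {ι : Type*} {l : Filter ι} (a b : ι → ℕ) (ha : Tendsto a l atTop) (hb : Tendsto b l atTop) (s : ℝ)
    (u : ι → ℝ) (hu : ∀ p, u p = s * b p / Real.sqrt (v * (a p + b p) * a p * b p)) :
    Tendsto (fun p => ((∑ x, Complex.exp (u p * g x * Complex.I)) / (Fintype.card V : ℂ)) ^ (a p) -
      Complex.exp (-(v * u p ^ 2 / 2 : ℝ)) ^ (a p)) l (𝓝 0) := by
  obtain ⟨C, δ, hδ, hC, H⟩ := phi_bound g hg v hv
  have hc : (0:ℝ) < (Fintype.card V : ℝ) := by exact_mod_cast Fintype.card_pos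
  have hu0 : Tendsto u l (𝓝 0) := by
    have := u_tendsto a b ha hb v hv0 s
    refine this.congr fun p => (hu p).symm
  have hb0 : Tendsto (fun p => C * (s ^ 2 / v) * |u p|) l (𝓝 0) := by
    have := (hu0.abs).const_mul (C * (s ^ 2 / v))
    simpa using this
  refine squeeze_zero_norm' ?_ hb0
  have hev : ∀ᶠ p in l, |u p| ≤ δ := by
    have := hu0.abs
    rw [abs_zero] at this
    exact (this.eventually_lt_const hδ).mono fun _ h => h.le
  filter_upwards [ha.eventually_gt_atTop 0, hb.eventually_gt_atTop 0, hev] with p hpa hpb hp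
  have hpa' : (0:ℝ) < a p := by exact_mod_cast hpa
  have hpb' : (0:ℝ) < b p := by exact_mod_cast hpb
  refine (pow_sub_pow_le _ _ ?_ ?_ _).trans ?_
  · rw [norm_div, Complex.norm_natCast, div_le_one hc]
    refine (norm_sum_le _ _).trans ?_
    refine (Finset.sum_le_sum (g := fun _ => (1:ℝ)) fun x _ => ?_).trans (by simp)
    have := Complex.norm_exp_ofReal_mul_I (u p * g x)
    push_cast at this
    rw [this]
  · rw [← Complex.ofReal_neg, Complex.norm_exp_ofReal]
    simp only [Real.exp_le_one_iff]
    have : 0 ≤ v * u p ^ 2 / 2 := by positivity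
    linarith
  · have h1 : a p * (u p) ^ 2 ≤ s ^ 2 / v := by
      rw [hu, div_pow, Real.sq_sqrt (by positivity), mul_div_assoc', div_le_div_iff₀ (by positivity) (by positivity)]
      have : 0 ≤ s ^ 2 * v * a p * a p * b p := by positivity
      nlinarith
    calc (a p : ℝ) * _ ≤ a p * (C * |u p| ^ 3) := by gcongr; exact H _ hp
      _ = C * (a p * (u p) ^ 2) * |u p| := by rw [← sq_abs (u p)]; ring
      _ ≤ _ := by gcongr

lemma exp_diff (a b : ℝ) : ‖Complex.exp (a * Complex.I) - Complex.exp (b * Complex.I)‖ ≤ |a - b| := by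
  have : Complex.exp (a * Complex.I) - Complex.exp (b * Complex.I) =
      Complex.exp (b * Complex.I) * (Complex.exp (Complex.I * ((a - b : ℝ) : ℂ)) - 1) := by
    rw [mul_sub, ← Complex.exp_add]; push_cast; ring_nf
  rw [this, norm_mul, Complex.norm_exp_ofReal_mul_I, one_mul]
  exact Real.norm_exp_I_mul_ofReal_sub_one_le

lemma H_var {V : Type*} [Fintype V] [Nonempty V] (h : V → V → ℝ) (h1 : ∀ y, ∑ x, h x y = 0)
    (h2 : ∀ x, ∑ y, h x y = 0) (m n : ℕ) :
    ∑ Z : (Fin m → V) × (Fin n → V), (∑ i, ∑ j, h (Z.1 i) (Z.2 j)) ^ 2 =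
      m * n * ((∑ x, ∑ y, h x y ^ 2) / (Fintype.card V : ℝ) ^ 2) * (Fintype.card V : ℝ) ^ (m + n) := by
  have hc : (Fintype.card V : ℝ) ≠ 0 := by exact_mod_cast Fintype.card_ne_zero
  rw [Fintype.sum_prod_type_right]
  have e : ∀ Y : Fin n → V, ∑ X : Fin m → V, (∑ i, ∑ j, h (X i) (Y j)) ^ 2 =
      m * (∑ x, (∑ j, h x (Y j)) ^ 2) / Fintype.card V * (Fintype.card V : ℝ) ^ m := by
    intro Y
    refine (var_sum (fun x => ∑ j, h x (Y j)) ?_ m).2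
    rw [Finset.sum_comm]
    simp [h1]
  simp only [e]
  rw [← Finset.sum_mul, ← Finset.sum_div, ← Finset.mul_sum, Finset.sum_comm]
  have e2 : ∀ x, ∑ Y : Fin n → V, (∑ j, h x (Y j)) ^ 2 = n * (∑ y, h x y ^ 2) / Fintype.card V * (Fintype.card V : ℝ) ^ n :=
    fun x => (var_sum (h x) (h2 x) n).2
  simp only [e2]
  rw [← Finset.sum_mul, ← Finset.sum_div, ← Finset.mul_sum]
  field_simp
  ring

lemma clt_iid {V : Type*} [Fintype V] [Nonempty V] (g : V → ℝ) (hg : ∑ x, g x = 0) (v : ℝ) (hv0 : 0 < v)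
    (hv : ∑ x, g x ^ 2 = v * Fintype.card V)
    (h : V → V → ℝ) (h1 : ∀ y, ∑ x, h x y = 0) (h2 : ∀ x, ∑ y, h x y = 0) (s : ℝ) :
    Tendsto (fun p : ℕ × ℕ => (∑ Z : (Fin p.1 → V) × (Fin p.2 → V),
      Complex.exp (s * (((p.2 * ∑ i, g (Z.1 i) + p.1 * ∑ j, g (Z.2 j) + ∑ i, ∑ j, h (Z.1 i) (Z.2 j)) /
        Real.sqrt (v * (p.1 + p.2) * p.1 * p.2) : ℝ) : ℂ) * Complex.I)) / (Fintype.card V : ℂ) ^ (p.1 + p.2))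
      atTop (𝓝 (Complex.exp (-(s:ℂ)^2/2))) := by
  have hc : (0:ℝ) < (Fintype.card V : ℝ) := by exact_mod_cast Fintype.card_pos
  have hcC : (Fintype.card V : ℂ) ≠ 0 := by exact_mod_cast Fintype.card_ne_zero
  have tf : Tendsto (fun p : ℕ × ℕ => p.1) atTop atTop := by
    rw [← prod_atTop_atTop_eq]; exact tendsto_fst
  have ts : Tendsto (fun p : ℕ × ℕ => p.2) atTop atTop := by
    rw [← prod_atTop_atTop_eq]; exact tendsto_snd
  set σ : ℕ × ℕ → ℝ := fun p => Real.sqrt (v * (p.1 + p.2) * p.1 * p.2) with hσ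
  let a : ℕ × ℕ → ℝ := fun p => s * p.2 / σ p
  let b : ℕ × ℕ → ℝ := fun p => s * p.1 / σ p
  have L1 := phi_pow g hg v hv0 hv (fun p : ℕ × ℕ => p.1) (fun p => p.2) tf ts s a (fun p => rfl)
  have L2 := phi_pow g hg v hv0 hv (fun p : ℕ × ℕ => p.2) (fun p => p.1) ts tf s b
    (fun p => by simp only [b, hσ]; congr 2; ring)
  let φ : ℝ → ℂ := fun u => (∑ x, Complex.exp (u * g x * Complex.I)) / (Fintype.card V : ℂ)
  have hφ : ∀ u, ‖φ u‖ ≤ 1 := by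
    intro u
    simp only [φ]
    rw [norm_div, Complex.norm_natCast, div_le_one hc]
    refine (norm_sum_le _ _).trans ?_
    refine (Finset.sum_le_sum (g := fun _ => (1:ℝ)) fun x _ => ?_).trans (by simp)
    have := Complex.norm_exp_ofReal_mul_I (u * g x)
    push_cast at this
    rw [this]
  have hev : ∀ᶠ p : ℕ × ℕ in atTop, 0 < p.1 ∧ 0 < p.2 :=
    (tf.eventually_gt_atTop 0).and (ts.eventually_gt_atTop 0)
  -- product of the two factors
  have L3 : Tendsto (fun p : ℕ × ℕ => φ (a p) ^ p.1 * φ (b p) ^ p.2) atTop (𝓝 (Complex.exp (-(s:ℂ)^2/2))) := by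
    have key : Tendsto (fun p : ℕ × ℕ => φ (a p) ^ p.1 * φ (b p) ^ p.2 -
        Complex.exp (-(v * a p ^ 2 / 2 : ℝ)) ^ p.1 * Complex.exp (-(v * b p ^ 2 / 2 : ℝ)) ^ p.2) atTop (𝓝 0) := by
      have hb := (L1.norm).add (L2.norm)
      rw [norm_zero, add_zero] at hb
      refine squeeze_zero_norm (fun p => ?_) hb
      have hE : ∀ w : ℝ, ‖Complex.exp (-(v * w ^ 2 / 2 : ℝ))‖ ≤ 1 := by
        intro w
        rw [← Complex.ofReal_neg, Complex.norm_exp_ofReal]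
        simp only [Real.exp_le_one_iff]
        have : 0 ≤ v * w ^ 2 / 2 := by positivity
        linarith
      have e1 : ∀ A B A' B' : ℂ, A * B - A' * B' = (A - A') * B + A' * (B - B') := by intros; ring
      rw [e1]
      refine (norm_add_le _ _).trans ?_
      rw [norm_mul, norm_mul]
      have n1 : ‖φ (b p) ^ p.2‖ ≤ 1 := by rw [norm_pow]; exact pow_le_one₀ (norm_nonneg _) (hφ _)
      have n2 : ‖Complex.exp (-(v * a p ^ 2 / 2 : ℝ)) ^ p.1‖ ≤ 1 := by
        rw [norm_pow]; exact pow_le_one₀ (norm_nonneg _) (hE _)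
      refine add_le_add ?_ ?_
      · exact mul_le_of_le_one_right (norm_nonneg _) n1
      · exact mul_le_of_le_one_left (norm_nonneg _) n2
    have lim2 : Tendsto (fun p : ℕ × ℕ => Complex.exp (-(v * a p ^ 2 / 2 : ℝ)) ^ p.1 * Complex.exp (-(v * b p ^ 2 / 2 : ℝ)) ^ p.2)
        atTop (𝓝 (Complex.exp (-(s:ℂ)^2/2))) := by
      refine tendsto_const_nhds.congr' ?_
      filter_upwards [hev] with p hp
      have hpa' : (0:ℝ) < p.1 := by exact_mod_cast hp.1
      have hpb' : (0:ℝ) < p.2 := by exact_mod_cast hp.2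
      rw [← Complex.exp_nat_mul, ← Complex.exp_nat_mul, ← Complex.exp_add]
      congr 1
      have : p.1 * (-(v * a p ^ 2 / 2)) + p.2 * (-(v * b p ^ 2 / 2)) = - s ^ 2 / 2 := by
        simp only [a, b, div_pow, hσ]
        rw [Real.sq_sqrt (by positivity)]
        field_simp
        ring
      exact_mod_cast (congrArg Complex.ofReal this).symm
    simpa using key.add lim2
  -- the perturbation
  have L4 : Tendsto (fun p : ℕ × ℕ => (∑ Z : (Fin p.1 → V) × (Fin p.2 → V),
      Complex.exp (s * (((p.2 * ∑ i, g (Z.1 i) + p.1 * ∑ j, g (Z.2 j) + ∑ i, ∑ j, h (Z.1 i) (Z.2 j)) /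
        σ p : ℝ) : ℂ) * Complex.I)) / (Fintype.card V : ℂ) ^ (p.1 + p.2) - φ (a p) ^ p.1 * φ (b p) ^ p.2) atTop (𝓝 0) := by
    set η := (∑ x, ∑ y, h x y ^ 2) / (Fintype.card V : ℝ) ^ 2 with hη
    have hη0 : 0 ≤ η := by positivity
    have hb : Tendsto (fun p : ℕ × ℕ => |s| * Real.sqrt (η / (v * p.1))) atTop (𝓝 0) := by
      have : Tendsto (fun p : ℕ × ℕ => η / (v * p.1)) atTop (𝓝 0) :=
        Tendsto.div_atTop tendsto_const_nhds ((tendsto_natCast_atTop_atTop.comp tf).const_mul_atTop hv0)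
      have := (this.sqrt).const_mul |s|
      simpa using this
    refine squeeze_zero_norm' ?_ hb
    filter_upwards [hev] with p hp
    have hpa' : (0:ℝ) < p.1 := by exact_mod_cast hp.1
    have hpb' : (0:ℝ) < p.2 := by exact_mod_cast hp.2
    have hσ0 : 0 < σ p := by simp only [hσ]; positivity
    have e1 : φ (a p) ^ p.1 * φ (b p) ^ p.2 = (∑ Z : (Fin p.1 → V) × (Fin p.2 → V),
      Complex.exp (((s * ((p.2 * ∑ i, g (Z.1 i) + p.1 * ∑ j, g (Z.2 j)) / σ p) : ℝ) : ℂ) * Complex.I)) / (Fintype.card V : ℂ) ^ (p.1 + p.2) := by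
      simp only [φ]
      rw [div_pow, div_pow, pow_add, div_mul_div_comm, ← exp_sum, ← exp_sum, Finset.sum_mul_sum, Fintype.sum_prod_type]
      congr 1
      refine Finset.sum_congr rfl fun X _ => Finset.sum_congr rfl fun Y _ => ?_
      rw [← Complex.exp_add]
      congr 1
      rw [← Finset.sum_mul, ← Finset.sum_mul, ← Finset.mul_sum, ← Finset.mul_sum]
      simp only [a, b]
      push_cast
      ring
    rw [e1, ← sub_div, ← Finset.sum_sub_distrib, norm_div, norm_pow, Complex.norm_natCast, div_le_iff₀ (by positivity)]
    refine (norm_sum_le _ _).trans ?_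
    have e2 : ∀ Z : (Fin p.1 → V) × (Fin p.2 → V), ‖Complex.exp (s * (((p.2 * ∑ i, g (Z.1 i) + p.1 * ∑ j, g (Z.2 j) + ∑ i, ∑ j, h (Z.1 i) (Z.2 j)) /
        σ p : ℝ) : ℂ) * Complex.I) - Complex.exp (((s * ((p.2 * ∑ i, g (Z.1 i) + p.1 * ∑ j, g (Z.2 j)) / σ p) : ℝ) : ℂ) * Complex.I)‖ ≤
        |s| / σ p * |∑ i, ∑ j, h (Z.1 i) (Z.2 j)| := by
      intro Z
      rw [← Complex.ofReal_mul]
      refine (exp_diff _ _).trans (le_of_eq ?_)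
      rw [← mul_sub, ← sub_div, add_sub_cancel_left, abs_mul, abs_div, abs_of_pos hσ0]
      ring
    refine (Finset.sum_le_sum fun Z _ => e2 Z).trans ?_
    rw [← Finset.mul_sum]
    have cs := sq_sum_le_card_mul_sum_sq (s := (Finset.univ : Finset ((Fin p.1 → V) × (Fin p.2 → V))))
      (f := fun Z => |∑ i, ∑ j, h (Z.1 i) (Z.2 j)|)
    simp only [sq_abs] at cs
    rw [H_var h h1 h2, ← hη] at cs
    simp only [Finset.card_univ, Fintype.card_prod, Fintype.card_pi, Finset.prod_const, Fintype.card_fin] at cs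
    push_cast at cs
    rw [← pow_add] at cs
    have e3 : ∑ Z : (Fin p.1 → V) × (Fin p.2 → V), |∑ i, ∑ j, h (Z.1 i) (Z.2 j)| ≤
        Real.sqrt (p.1 * p.2 * η) * (Fintype.card V : ℝ) ^ (p.1 + p.2) := by
      refine abs_le_of_sq_le_sq' ?_ (by positivity) |>.2
      rw [mul_pow, Real.sq_sqrt (by positivity)]
      refine cs.trans (le_of_eq (by ring))
    calc _ ≤ |s| / σ p * (Real.sqrt (p.1 * p.2 * η) * (Fintype.card V : ℝ) ^ (p.1 + p.2)) := by gcongr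
      _ = |s| * (Real.sqrt (p.1 * p.2 * η) / σ p) * (Fintype.card V : ℝ) ^ (p.1 + p.2) := by ring
      _ ≤ _ := by
        gcongr
        simp only [hσ]
        rw [← Real.sqrt_div (by positivity)]
        apply Real.sqrt_le_sqrt
        rw [div_le_div_iff₀ (by positivity) (by positivity)]
        have : 0 ≤ p.1 * p.2 * η * v * p.2 := by positivity
        nlinarith
  have L5 := L4.add L3
  simp only [sub_add_cancel, zero_add] at L5
  exact L5

lemma fac_exists {F : Type*} [Field F] {m n r : ℕ} (M : Matrix (Fin m) (Fin n) F) (h : M.rank = r) :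
    ∃ (X : Matrix (Fin m) (Fin r) F) (Y : Matrix (Fin r) (Fin n) F), X * Y = M := by
  have hf : Module.finrank F (LinearMap.range M.mulVecLin) = Module.finrank F (Fin r → F) := by
    rw [Module.finrank_fin_fun]; exact h
  let e := LinearEquiv.ofFinrankEq _ _ hf
  refine ⟨LinearMap.toMatrix' ((LinearMap.range M.mulVecLin).subtype ∘ₗ e.symm.toLinearMap),
    LinearMap.toMatrix' (e.toLinearMap ∘ₗ M.mulVecLin.rangeRestrict), ?_⟩
  rw [← LinearMap.toMatrix'_comp]
  have : ((LinearMap.range M.mulVecLin).subtype ∘ₗ e.symm.toLinearMap) ∘ₗ (e.toLinearMap ∘ₗ M.mulVecLin.rangeRestrict)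
      = M.mulVecLin := by
    ext x; simp
  rw [this]
  exact LinearMap.toMatrix'_toLin' M

lemma leftInv_of_inj {F : Type*} [Field F] {m r : ℕ} (X : Matrix (Fin m) (Fin r) F)
    (h : ∀ v, X.mulVec v = 0 → v = 0) : ∃ L : Matrix (Fin r) (Fin m) F, L * X = 1 := by
  have hk : LinearMap.ker X.mulVecLin = ⊥ := by
    rw [LinearMap.ker_eq_bot']; exact h
  obtain ⟨g, hg⟩ := LinearMap.exists_leftInverse_of_injective _ hk
  refine ⟨LinearMap.toMatrix' g, ?_⟩
  have := congrArg LinearMap.toMatrix' hg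
  rw [LinearMap.toMatrix'_comp, LinearMap.toMatrix'_id] at this
  have h2 : LinearMap.toMatrix' X.mulVecLin = X := LinearMap.toMatrix'_toLin' X
  rwa [h2] at this

lemma leftInv_of_rank {F : Type*} [Field F] {m r : ℕ} (X : Matrix (Fin m) (Fin r) F)
    (h : X.rank = r) : ∃ L : Matrix (Fin r) (Fin m) F, L * X = 1 := by
  apply leftInv_of_inj
  have h1 := LinearMap.finrank_range_add_finrank_ker X.mulVecLin
  have h2 : Module.finrank F (LinearMap.range X.mulVecLin) = r := h
  rw [h2, Module.finrank_fin_fun] at h1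
  have h3 : LinearMap.ker X.mulVecLin = ⊥ := Submodule.finrank_eq_zero.1 (by omega)
  rw [LinearMap.ker_eq_bot'] at h3
  exact h3

lemma inv_of_rank_mul {F : Type*} [Field F] {m n r : ℕ} (X : Matrix (Fin m) (Fin r) F) (Y : Matrix (Fin r) (Fin n) F)
    (h : (X * Y).rank = r) : (∃ L : Matrix (Fin r) (Fin m) F, L * X = 1) ∧
      ∃ R : Matrix (Fin n) (Fin r) F, Y * R = 1 := by
  constructor
  · apply leftInv_of_rank
    have := Matrix.rank_mul_le_left X Y
    have := Matrix.rank_le_width X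
    omega
  · obtain ⟨L, hL⟩ := leftInv_of_rank Y.transpose (by
      rw [Matrix.rank_transpose]
      have := Matrix.rank_mul_le_right X Y
      have := Matrix.rank_le_height Y
      omega)
    refine ⟨L.transpose, ?_⟩
    have := congrArg Matrix.transpose hL
    simpa using this

lemma rank_of_inv {F : Type*} [Field F] {m n r : ℕ} (X : Matrix (Fin m) (Fin r) F) (Y : Matrix (Fin r) (Fin n) F)
    (L : Matrix (Fin r) (Fin m) F) (hL : L * X = 1) (R : Matrix (Fin n) (Fin r) F) (hR : Y * R = 1) :
    (X * Y).rank = r := by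
  have h1 := Matrix.rank_mul_le_left X Y
  have h2 := Matrix.rank_le_width X
  have e : L * (X * Y * R) = 1 := by
    rw [Matrix.mul_assoc X, hR, Matrix.mul_one, hL]
  have h3 := Matrix.rank_mul_le_right L (X * Y * R)
  have h4 := Matrix.rank_mul_le_left (X * Y) R
  rw [e, Matrix.rank_one, Fintype.card_fin] at h3
  omega

/-- the matrix of dot products -/
def dmat {F : Type*} [Field F] {m n r : ℕ} (Z : (Fin m → Fin r → F) × (Fin n → Fin r → F)) : Matrix (Fin m) (Fin n) F :=
  Matrix.of fun i j => Z.1 i ⬝ᵥ Z.2 j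

lemma dmat_eq {F : Type*} [Field F] {m n r : ℕ} (Z : (Fin m → Fin r → F) × (Fin n → Fin r → F)) :
    dmat Z = Matrix.of Z.1 * (Matrix.of Z.2).transpose := by
  ext i j
  simp [dmat, Matrix.mul_apply, dotProduct]

lemma fiber_card {F : Type*} [Field F] [Fintype F] [DecidableEq F] {m n r : ℕ} (M : Matrix (Fin m) (Fin n) F) (h : M.rank = r) :
    (Finset.univ.filter (fun Z : (Fin m → Fin r → F) × (Fin n → Fin r → F) => dmat Z = M)).card =
      Fintype.card (GL (Fin r) F) := by
  obtain ⟨X, Y, hXY⟩ := fac_exists M h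
  obtain ⟨⟨L, hL⟩, ⟨R, hR⟩⟩ := inv_of_rank_mul X Y (by rw [hXY, h])
  symm
  rw [← Finset.card_univ]
  refine Finset.card_bij (fun g _ => (fun i => (X * g.1) i, fun j => (g⁻¹.1 * Y).transpose j)) ?_ ?_ ?_
  · intro g _
    simp only [Finset.mem_filter, Finset.mem_univ, true_and, dmat_eq]
    change (X * g.1) * ((g⁻¹.1 * Y).transpose).transpose = M
    rw [Matrix.transpose_transpose, Matrix.mul_assoc, ← Matrix.mul_assoc g.1, ← Units.val_mul]
    simp [hXY]
  · intro g _ g' _ hg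
    have h1 : X * g.1 = X * g'.1 := congrArg Prod.fst hg
    have h2 := congrArg (fun W => L * W) h1
    simp only [← Matrix.mul_assoc, hL, Matrix.one_mul] at h2
    exact Units.ext h2
  · rintro ⟨X1, Y1⟩ hZ
    simp only [Finset.mem_filter, Finset.mem_univ, true_and, dmat_eq] at hZ
    set A : Matrix (Fin m) (Fin r) F := Matrix.of X1 with hA
    set B : Matrix (Fin r) (Fin n) F := (Matrix.of Y1).transpose with hB
    have hgh : (L * A) * (B * R) = 1 := by
      calc (L * A) * (B * R) = L * (A * B) * R := by simp only [Matrix.mul_assoc]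
        _ = (L * X) * (Y * R) := by rw [hZ, ← hXY]; simp only [Matrix.mul_assoc]
        _ = 1 := by rw [hL, hR, Matrix.mul_one]
    have hhg : (B * R) * (L * A) = 1 := mul_eq_one_comm.1 hgh
    refine ⟨⟨L * A, B * R, hgh, hhg⟩, Finset.mem_univ _, ?_⟩
    have hX : X = A * (B * R) := by
      rw [← Matrix.mul_assoc, hZ, ← hXY, Matrix.mul_assoc, hR, Matrix.mul_one]
    have hY : Y = (L * A) * B := by
      rw [Matrix.mul_assoc, hZ, ← hXY, ← Matrix.mul_assoc, hL, Matrix.one_mul]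
    have r1 : X * (L * A) = A := by
      conv_lhs => rw [hX]
      rw [Matrix.mul_assoc, hhg, Matrix.mul_one]
    have r2 : (B * R) * Y = B := by
      conv_lhs => rw [hY]
      rw [← Matrix.mul_assoc, hhg, Matrix.one_mul]
    refine Prod.ext ?_ ?_
    · exact r1
    · change ((B * R) * Y).transpose = _
      rw [r2]; rfl

lemma unif {F : Type*} [Field F] [Fintype F] {r : ℕ} (f : F → ℝ) (v : Fin r → F) (hv : v ≠ 0) :
    (Fintype.card F : ℝ) * ∑ x : Fin r → F, f (x ⬝ᵥ v) = (Fintype.card (Fin r → F) : ℝ) * ∑ a, f a := by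
  classical
  obtain ⟨k, hk⟩ := Function.ne_iff.1 hv
  have h1 : ∀ a : F, ∑ x : Fin r → F, f (x ⬝ᵥ v) = ∑ x : Fin r → F, f (x ⬝ᵥ v + a) := by
    intro a
    rw [← Equiv.sum_comp (Equiv.addRight (Pi.single k (a * (v k)⁻¹)))]
    refine Finset.sum_congr rfl fun x _ => ?_
    have : v k ≠ 0 := hk
    simp [add_dotProduct, this]
  have h2 : ∑ a : F, ∑ x : Fin r → F, f (x ⬝ᵥ v) = ∑ a : F, ∑ x : Fin r → F, f (x ⬝ᵥ v + a) :=
    Finset.sum_congr rfl fun a _ => h1 a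
  rw [Finset.sum_comm (f := fun a x => f (x ⬝ᵥ v + a))] at h2
  have h3 : ∀ b : F, ∑ a, f (b + a) = ∑ a, f a := fun b => Equiv.sum_comp (Equiv.addLeft b) f
  simp only [h3, Finset.sum_const, nsmul_eq_mul, Finset.card_univ] at h2
  exact h2

lemma bad_one {F : Type*} [Field F] [Fintype F] [DecidableEq F] (m r : ℕ) :
    ((Finset.univ.filter (fun X : Fin m → Fin r → F => ∃ v : Fin r → F, v ≠ 0 ∧ ∀ i, X i ⬝ᵥ v = 0)).card : ℝ) ≤
      Fintype.card (Fin r → F) * ((Fintype.card (Fin r → F) : ℝ) ^ m * ((Fintype.card F : ℝ)⁻¹) ^ m) := by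
  have hq : (0:ℝ) < Fintype.card F := by exact_mod_cast Fintype.card_pos
  have hsub : (Finset.univ.filter (fun X : Fin m → Fin r → F => ∃ v : Fin r → F, v ≠ 0 ∧ ∀ i, X i ⬝ᵥ v = 0)) ⊆
      (Finset.univ.filter (fun v : Fin r → F => v ≠ 0)).biUnion
        (fun v => Fintype.piFinset (fun _ : Fin m => Finset.univ.filter (fun x : Fin r → F => x ⬝ᵥ v = 0))) := by
    intro X hX
    simpa using hX
  have hcard : ∀ v : Fin r → F, v ≠ 0 →
      ((Fintype.piFinset (fun _ : Fin m => Finset.univ.filter (fun x : Fin r → F => x ⬝ᵥ v = 0))).card : ℝ) =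
      (Fintype.card (Fin r → F) : ℝ) ^ m * ((Fintype.card F : ℝ)⁻¹) ^ m := by
    intro v hv
    have := unif (fun a => if a = 0 then 1 else 0) v hv
    simp only [Finset.sum_ite_eq', Finset.mem_univ, if_true, mul_one, Finset.sum_boole] at this
    rw [Fintype.card_piFinset, Finset.prod_const, Finset.card_univ, Fintype.card_fin, ← mul_pow, Nat.cast_pow]
    congr 1
    rw [← this]; field_simp
  calc _ ≤ (((Finset.univ.filter (fun v : Fin r → F => v ≠ 0)).biUnion
        (fun v => Fintype.piFinset (fun _ : Fin m => Finset.univ.filter (fun x : Fin r → F => x ⬝ᵥ v = 0)))).card : ℝ) := by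
        exact_mod_cast Finset.card_le_card hsub
    _ ≤ ∑ v ∈ (Finset.univ.filter (fun v : Fin r → F => v ≠ 0)),
        ((Fintype.piFinset (fun _ : Fin m => Finset.univ.filter (fun x : Fin r → F => x ⬝ᵥ v = 0))).card : ℝ) := by
        exact_mod_cast Finset.card_biUnion_le
    _ = ∑ v ∈ (Finset.univ.filter (fun v : Fin r → F => v ≠ 0)),
        ((Fintype.card (Fin r → F) : ℝ) ^ m * ((Fintype.card F : ℝ)⁻¹) ^ m) :=
        Finset.sum_congr rfl fun v hv => hcard v (Finset.mem_filter.1 hv).2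
    _ ≤ _ := by
        rw [Finset.sum_const, nsmul_eq_mul]
        gcongr
        exact Finset.card_le_univ _

lemma bad_two {F : Type*} [Field F] [Fintype F] [DecidableEq F] (m n r : ℕ) :
    ((Finset.univ.filter (fun Z : (Fin m → Fin r → F) × (Fin n → Fin r → F) => ¬ (dmat Z).rank = r)).card : ℝ) ≤
      Fintype.card (Fin r → F) * (((Fintype.card F : ℝ)⁻¹) ^ m + ((Fintype.card F : ℝ)⁻¹) ^ n) *
        (Fintype.card (Fin r → F) : ℝ) ^ (m + n) := by
  have hsub : (Finset.univ.filter (fun Z : (Fin m → Fin r → F) × (Fin n → Fin r → F) => ¬ (dmat Z).rank = r)) ⊆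
    ((Finset.univ.filter (fun X : Fin m → Fin r → F => ∃ v : Fin r → F, v ≠ 0 ∧ ∀ i, X i ⬝ᵥ v = 0)) ×ˢ Finset.univ) ∪
    (Finset.univ ×ˢ (Finset.univ.filter (fun X : Fin n → Fin r → F => ∃ v : Fin r → F, v ≠ 0 ∧ ∀ i, X i ⬝ᵥ v = 0))) := by
    intro Z hZ
    by_contra hcon
    simp only [Finset.mem_union, Finset.mem_product, Finset.mem_filter, Finset.mem_univ, true_and, and_true, not_or,
      not_exists, not_and] at hcon hZ
    apply hZ
    obtain ⟨L, hL⟩ := leftInv_of_inj (Matrix.of Z.1) (fun v hv => by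
      by_contra hv0
      exact hcon.1 v hv0 (fun i => congrFun hv i))
    obtain ⟨R, hR⟩ := leftInv_of_inj (Matrix.of Z.2) (fun v hv => by
      by_contra hv0
      exact hcon.2 v hv0 (fun i => congrFun hv i))
    rw [dmat_eq]
    refine rank_of_inv _ _ L hL R.transpose ?_
    have := congrArg Matrix.transpose hR
    simpa using this
  have h1 := bad_one (F := F) m r
  have h2 := bad_one (F := F) n r
  have h3 := (Finset.card_le_card hsub).trans (Finset.card_union_le _ _)
  rw [Finset.card_product, Finset.card_product, Finset.card_univ, Finset.card_univ] at h3
  simp only [Fintype.card_pi (α := fun _ : Fin m => Fin r → F), Fintype.card_pi (α := fun _ : Fin n => Fin r → F),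
    Finset.prod_const, Finset.card_univ, Fintype.card_fin] at h3
  have h4 := (Nat.cast_le (α := ℝ)).2 h3
  refine h4.trans ?_
  set N : ℝ := (Fintype.card (Fin r → F) : ℝ) with hN
  push_cast
  rw [← hN]
  calc _ ≤ (N * (N ^ m * ((Fintype.card F : ℝ)⁻¹) ^ m)) * N ^ n + N ^ m * (N * (N ^ n * ((Fintype.card F : ℝ)⁻¹) ^ n)) := by gcongr
    _ = _ := by ring

lemma transfer {F : Type*} [Field F] [Fintype F] [DecidableEq F] (m n r : ℕ) (G : Matrix (Fin m) (Fin n) F → ℂ)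
    (hG : ∀ M, ‖G M‖ ≤ 1) :
    ‖(∑ Z : (Fin m → Fin r → F) × (Fin n → Fin r → F), G (dmat Z)) / (Fintype.card (Fin r → F) : ℂ) ^ (m + n) -
      (∑ M : {M : Matrix (Fin m) (Fin n) F // M.rank = r}, G M) / (Fintype.card {M : Matrix (Fin m) (Fin n) F // M.rank = r} : ℂ)‖ ≤
      2 * (Fintype.card (Fin r → F) * (((Fintype.card F : ℝ)⁻¹) ^ m + ((Fintype.card F : ℝ)⁻¹) ^ n)) := by
  set c : ℕ := Fintype.card (GL (Fin r) F) with hc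
  have hc0 : (c : ℂ) ≠ 0 := by exact_mod_cast Fintype.card_ne_zero
  set good := Finset.univ.filter (fun Z : (Fin m → Fin r → F) × (Fin n → Fin r → F) => (dmat Z).rank = r) with hgood
  have key : ∀ G : Matrix (Fin m) (Fin n) F → ℂ, ∑ Z ∈ good, G (dmat Z) =
      c * ∑ M : {M : Matrix (Fin m) (Fin n) F // M.rank = r}, G M := by
    intro G
    rw [← Finset.sum_fiberwise_of_maps_to (t := Finset.univ.filter (fun M : Matrix (Fin m) (Fin n) F => M.rank = r)) (g := dmat)]
    · rw [Finset.mul_sum, ← Finset.sum_subtype (p := fun M : Matrix (Fin m) (Fin n) F => M.rank = r) (F := inferInstance) (Finset.univ.filter (fun M : Matrix (Fin m) (Fin n) F => M.rank = r)) (by simp) (fun M => (c:ℂ) * G M)]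
      refine Finset.sum_congr rfl fun M hM => ?_
      have hM' := (Finset.mem_filter.1 hM).2
      rw [Finset.sum_congr rfl (g := fun _ => G M) (fun Z hZ => by rw [(Finset.mem_filter.1 hZ).2]), Finset.sum_const, nsmul_eq_mul]
      congr 2
      rw [hc, ← fiber_card M hM']
      congr 1
      ext Z
      simp only [hgood, Finset.mem_filter, Finset.mem_univ, true_and]
      constructor
      · exact fun h => h.2
      · intro h; exact ⟨by rw [h, hM'], h⟩
    · intro Z hZ
      simpa [hgood] using hZ
  have k1 := key G
  have k2 := key (fun _ => 1)
  simp only [Finset.sum_const, nsmul_eq_mul, mul_one, Finset.card_univ] at k2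
  have e1 : (∑ M : {M : Matrix (Fin m) (Fin n) F // M.rank = r}, G M) / (Fintype.card {M : Matrix (Fin m) (Fin n) F // M.rank = r} : ℂ)
     = (∑ Z ∈ good, G (dmat Z)) / (good.card : ℂ) := by
    rw [k1, k2, mul_div_mul_left _ _ hc0]
  rw [e1]
  set bad := Finset.univ.filter (fun Z : (Fin m → Fin r → F) × (Fin n → Fin r → F) => ¬ (dmat Z).rank = r) with hbad
  have hb := bad_two (F := F) m n r
  rw [← hbad] at hb
  have hN : (0:ℝ) < Fintype.card (Fin r → F) := by exact_mod_cast Fintype.card_pos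
  set t : ℝ := (Fintype.card (Fin r → F) : ℝ) ^ (m + n) with ht
  have ht0 : 0 < t := by positivity
  have htot : (good.card : ℝ) + bad.card = t := by
    have := Finset.card_filter_add_card_filter_not (s := (Finset.univ : Finset ((Fin m → Fin r → F) × (Fin n → Fin r → F)))) (fun Z => (dmat Z).rank = r)
    rw [← hgood, ← hbad] at this
    rw [← Nat.cast_add, this, ht, Finset.card_univ, Fintype.card_prod, Fintype.card_pi (α := fun _ : Fin m => Fin r → F),
      Fintype.card_pi (α := fun _ : Fin n => Fin r → F)]
    simp only [Finset.prod_const, Finset.card_univ, Fintype.card_fin]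
    push_cast
    rw [pow_add]
  have htC : (Fintype.card (Fin r → F) : ℂ) ^ (m + n) = (t : ℂ) := by rw [ht]; push_cast; rfl
  rw [htC, ← Finset.sum_filter_add_sum_filter_not Finset.univ (fun Z => (dmat Z).rank = r), ← hgood, ← hbad]
  have n1 : ‖∑ Z ∈ good, G (dmat Z)‖ ≤ good.card :=
    (norm_sum_le _ _).trans ((Finset.sum_le_sum fun Z _ => hG (dmat Z)).trans (by simp))
  have n2 : ‖∑ Z ∈ bad, G (dmat Z)‖ ≤ bad.card :=
    (norm_sum_le _ _).trans ((Finset.sum_le_sum fun Z _ => hG (dmat Z)).trans (by simp))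
  have hb' : (bad.card : ℝ) / t ≤ Fintype.card (Fin r → F) * (((Fintype.card F : ℝ)⁻¹) ^ m + ((Fintype.card F : ℝ)⁻¹) ^ n) := by
    rw [div_le_iff₀ ht0]; exact hb
  refine le_trans ?_ (mul_le_mul_of_nonneg_left hb' (by norm_num : (0:ℝ) ≤ 2))
  set S := ∑ Z ∈ good, G (dmat Z)
  set S' := ∑ Z ∈ bad, G (dmat Z)
  have htC0 : (t : ℂ) ≠ 0 := by exact_mod_cast ht0.ne'
  by_cases hg0 : good.card = 0
  · have hS : S = 0 := by
      have : ‖S‖ ≤ 0 := by simpa [hg0] using n1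
      simpa using this
    rw [hS, zero_div, sub_zero, zero_add, norm_div, Complex.norm_real, Real.norm_eq_abs, abs_of_pos ht0]
    calc ‖S'‖ / t ≤ bad.card / t := by gcongr
      _ ≤ 2 * (bad.card / t) := by
        have : 0 ≤ (bad.card : ℝ) / t := by positivity
        linarith
  · have hgp : (0:ℝ) < good.card := by exact_mod_cast Nat.pos_of_ne_zero hg0
    have hgC : (good.card : ℂ) ≠ 0 := by exact_mod_cast hg0
    have e : (S + S') / (t : ℂ) - S / (good.card : ℂ) = S' / t - S / good.card * ((bad.card : ℝ) / t : ℝ) := by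
      have : (bad.card : ℂ) = t - good.card := by rw [← htot]; push_cast; ring
      push_cast
      rw [this]
      field_simp
      ring
    rw [e]
    refine (norm_sub_le _ _).trans ?_
    rw [norm_mul, norm_div, norm_div, Complex.norm_real, Complex.norm_real, Complex.norm_natCast, Real.norm_eq_abs, abs_of_pos ht0,
      Real.norm_eq_abs, abs_of_nonneg (by positivity)]
    calc _ ≤ (bad.card : ℝ) / t + 1 * (bad.card / t) := by
          gcongr
          rw [div_le_one hgp]; exact n1
      _ = _ := by ring

lemma gammaA_eq {F : Type*} [Field F] [Fintype F] [DecidableEq F] (A : Finset F) :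
    gammaA A = (A.card : ℝ) / Fintype.card F - if (0 : F) ∈ A then 1 else 0 := by
  have : ∀ a : F, (if a = 0 then 1 / (Fintype.card F : ℝ) - 1 else 1 / (Fintype.card F : ℝ)) =
      1 / (Fintype.card F : ℝ) - if a = 0 then 1 else 0 := by
    intro a; split_ifs <;> simp
  simp only [gammaA, this, Finset.sum_sub_distrib, Finset.sum_const, nsmul_eq_mul, Finset.sum_ite_eq']
  ring

lemma gammaA_ne {F : Type*} [Field F] [Fintype F] [DecidableEq F] (A : Finset F) (hA : A.Nonempty)
    (hA' : A ≠ Finset.univ) : gammaA A ≠ 0 := by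
  have hq : (0:ℝ) < Fintype.card F := by exact_mod_cast Fintype.card_pos
  have h1 : (0:ℝ) < A.card := by exact_mod_cast hA.card_pos
  have h2 : (A.card : ℝ) < Fintype.card F := by
    exact_mod_cast (Finset.card_lt_iff_ne_univ A).2 hA'
  rw [gammaA_eq]
  split_ifs
  · have : (A.card : ℝ) / Fintype.card F < 1 := by rwa [div_lt_one hq]
    linarith
  · have : 0 < (A.card : ℝ) / Fintype.card F := by positivity
    linarith

theorem entryCount_rank_matrix_clt
    {F : Type*} [Field F] [Fintype F] [DecidableEq F] (r : ℕ) (hr : 0 < r)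
    (A : Finset F) (hA : A.Nonempty) (hA' : A ≠ Finset.univ) :
    ∀ t : ℝ,
      Tendsto
        (fun p : ℕ × ℕ =>
          (Nat.card {M : Matrix (Fin p.1) (Fin p.2) F // M.rank = r ∧
              ((entryCount A M : ℝ) -
                  ((A.card / (Fintype.card F : ℝ) -
                      gammaA A / (Fintype.card F : ℝ) ^ r) * p.1 * p.2)) /
                Real.sqrt ((gammaA A) ^ 2 * ((Fintype.card F : ℝ) ^ r)⁻¹ *
                  (1 - ((Fintype.card F : ℝ) ^ r)⁻¹) * (p.1 + p.2) * p.1 * p.2) ≤ t} : ℝ) /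
            (Nat.card {M : Matrix (Fin p.1) (Fin p.2) F // M.rank = r} : ℝ))
        atTop
        (nhds ((ProbabilityTheory.gaussianReal 0 1 (Set.Iic t)).toReal)) := by
  intro t
  have hγ := gammaA_ne A hA hA'
  have hγe := gammaA_eq A
  set γ := gammaA A with hγdef
  have hq1 : (1:ℝ) < Fintype.card F := by exact_mod_cast Fintype.one_lt_card
  have hq : (0:ℝ) < Fintype.card F := by linarith
  set q : ℝ := (Fintype.card F : ℝ) with hqdef
  have hNq : (Fintype.card (Fin r → F) : ℝ) = q ^ r := by
    rw [Fintype.card_pi]; simp [hqdef]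
  set N : ℝ := q ^ r with hN
  have hN1 : 1 < N := one_lt_pow₀ hq1 hr.ne'
  have hN0 : 0 < N := by linarith
  set v : ℝ := γ ^ 2 * N⁻¹ * (1 - N⁻¹) with hv
  have hv0 : 0 < v := by
    have : N⁻¹ < 1 := inv_lt_one_of_one_lt₀ hN1
    have : 0 < 1 - N⁻¹ := by linarith
    positivity
  set μ : ℝ := A.card / q - γ / N with hμ
  let f : (Fin r → F) → (Fin r → F) → ℝ := fun x y => if x ⬝ᵥ y ∈ A then 1 else 0
  let g : (Fin r → F) → ℝ := fun x => γ / N - if x = 0 then γ else 0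
  let h : (Fin r → F) → (Fin r → F) → ℝ := fun x y => f x y - μ - g x - g y
  have hg : ∑ x, g x = 0 := by
    simp only [g, Finset.sum_sub_distrib, Finset.sum_const, nsmul_eq_mul, Finset.sum_ite_eq', Finset.card_univ, hNq,
      Finset.mem_univ, if_true]
    field_simp; ring
  have hg2 : ∑ x, g x ^ 2 = v * (Fintype.card (Fin r → F) : ℝ) := by
    have : ∀ x, g x ^ 2 = γ ^ 2 / N ^ 2 + if x = 0 then γ ^ 2 - 2 * γ ^ 2 / N else 0 := by
      intro x; simp only [g]; split_ifs <;> ring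
    simp only [this, Finset.sum_add_distrib, Finset.sum_const, nsmul_eq_mul, Finset.sum_ite_eq', Finset.card_univ, hNq,
      Finset.mem_univ, if_true, hv]
    field_simp; ring
  have hf1 : ∀ y, ∑ x, f x y = N * (A.card / q - if y = 0 then γ else 0) := by
    intro y
    by_cases hy : y = 0
    · subst hy
      simp only [f, dotProduct_zero, if_true, Finset.sum_const, nsmul_eq_mul, Finset.card_univ, hNq, hγe]
      ring
    · have := unif (fun a => if a ∈ A then (1:ℝ) else 0) y hy
      rw [hNq, ← hqdef] at this
      simp only [Finset.sum_ite_mem, Finset.univ_inter, Finset.sum_const, nsmul_eq_mul, mul_one] at this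
      simp only [hy, if_false, sub_zero, f]
      field_simp
      linarith
  have hsym : ∀ x y, h x y = h y x := by
    intro x y; simp only [h, f, dotProduct_comm x y]; ring
  have h1 : ∀ y, ∑ x, h x y = 0 := by
    intro y
    simp only [h, Finset.sum_sub_distrib, hf1, hg, Finset.sum_const, nsmul_eq_mul, Finset.card_univ, hNq]
    simp only [g, hμ]
    ring
  have h2 : ∀ x, ∑ y, h x y = 0 := by
    intro x; simp only [hsym x]; exact h1 x
  let T : ∀ p : ℕ × ℕ, Matrix (Fin p.1) (Fin p.2) F → ℝ := fun p M =>
    ((entryCount A M : ℝ) - (μ * p.1 * p.2)) / Real.sqrt (v * (p.1 + p.2) * p.1 * p.2)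
  have hT : ∀ (p : ℕ × ℕ) (Z : (Fin p.1 → Fin r → F) × (Fin p.2 → Fin r → F)), T p (dmat Z) =
      (p.2 * ∑ i, g (Z.1 i) + p.1 * ∑ j, g (Z.2 j) + ∑ i, ∑ j, h (Z.1 i) (Z.2 j)) /
        Real.sqrt (v * (p.1 + p.2) * p.1 * p.2) := by
    intro p Z
    simp only [T]
    congr 1
    have e : (entryCount A (dmat Z) : ℝ) = ∑ i, ∑ j, f (Z.1 i) (Z.2 j) := by
      simp only [entryCount, f, dmat, Matrix.of_apply]
      rw [← Fintype.sum_prod_type' (f := fun i j => if Z.1 i ⬝ᵥ Z.2 j ∈ A then (1:ℝ) else 0), Finset.sum_boole]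
      congr 1
    rw [e]
    simp only [h, Finset.sum_sub_distrib, Finset.sum_const, nsmul_eq_mul, Finset.card_univ, Fintype.card_fin, ← Finset.mul_sum]
    ring
  have main := levy_finite (fun p : ℕ × ℕ => {M : Matrix (Fin p.1) (Fin p.2) F // M.rank = r})
    (fun p M => T p M.1) ?_ t
  · refine main.congr fun p => ?_
    rw [Nat.card_eq_fintype_card (α := {M : Matrix (Fin p.1) (Fin p.2) F // M.rank = r})]
    congr 2
    exact Nat.card_congr (Equiv.subtypeSubtypeEquivSubtypeInter (fun M : Matrix (Fin p.1) (Fin p.2) F => M.rank = r) (fun M => T p M ≤ t))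
  · intro s
    have c := clt_iid g hg v hv0 hg2 h h1 h2 s
    have tf : Tendsto (fun p : ℕ × ℕ => p.1) atTop atTop := by
      rw [← prod_atTop_atTop_eq]; exact tendsto_fst
    have ts : Tendsto (fun p : ℕ × ℕ => p.2) atTop atTop := by
      rw [← prod_atTop_atTop_eq]; exact tendsto_snd
    have hz : Tendsto (fun k : ℕ => (q⁻¹) ^ k) atTop (𝓝 0) :=
      tendsto_pow_atTop_nhds_zero_of_lt_one (by positivity) (inv_lt_one_of_one_lt₀ hq1)
    have hb := (((hz.comp tf).add (hz.comp ts)).const_mul (Fintype.card (Fin r → F) : ℝ)).const_mul 2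
    simp only [add_zero, mul_zero] at hb
    have d := squeeze_zero_norm (fun p : ℕ × ℕ => transfer (F := F) p.1 p.2 r
      (fun M => Complex.exp (s * T p M * Complex.I)) (fun M => by
        have := Complex.norm_exp_ofReal_mul_I (s * T p M)
        push_cast at this
        rw [this])) hb
    have c' := c.sub d
    simp only [hT, sub_sub_cancel, sub_zero] at c'
    exact c'
end
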